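/- Define ω(t) := ℓ₀(t) • R(Uⁿ) + ℓ₁(t) • R′(U^{n+1}), where ℓ₀(t) := (t_{n+1} − t)/k and ℓ₁(t) := (t − t_n)/k. Then for every t ∈ [t_n, t_{n+1}], Û(t) − ω(t) = −(1/2)·(t_{n+1} − t)·(t − t_n) • R′(W₁). -/

import Mathlib

/-- The integral of an affine function, expressed through its value at `m` and its slope. -/
theorem intervalIntegral_add_sub_smul {E : Type*} [NormedAddCommGroup E] [NormedSpace ℝ E]
    [CompleteSpace E] (a b m : ℝ) (x v : E) :
    ∫ s in a..b, (x + (s - m) • v) =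
      (b - a) • x + ((b - a) * ((a + b) / 2 - m)) • v := by
  rw [intervalIntegral.integral_add (Continuous.intervalIntegrable (by fun_prop) _ _)
    (Continuous.intervalIntegrable (by fun_prop) _ _), intervalIntegral.integral_const,
    intervalIntegral.integral_smul_const,
    intervalIntegral.integral_sub (Continuous.intervalIntegrable (by fun_prop) _ _)
    (Continuous.intervalIntegrable (by fun_prop) _ _), integral_id,
    intervalIntegral.integral_const, smul_eq_mul]
  congr 2
  ring

/-- Proposition 4.2 of the paper (formula (4.19)): with `R`, `R′`, `P` continuous linear,
`W` affine on `[tₙ, tₙ₊₁]` (`W(t) = W(t_{n+1/2}) + (t - t_{n+1/2}) • W₁`), the scheme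
relation `U¹ - P(U⁰) = k • W(t_{n+1/2})`, the time–space reconstruction
`Û(t) = R(U⁰) + ((t - tₙ)/k) • (R′(P(U⁰)) - R(U⁰)) + ∫_{tₙ}^t R′(W(s)) ds`, and the
interpolant `ω(t) = ℓ₀(t) • R(U⁰) + ℓ₁(t) • R′(U¹)`, one has, on `[tₙ, tₙ₊₁]`,
`Û(t) - ω(t) = -(1/2)(tₙ₊₁ - t)(t - tₙ) • R′(W₁)`. -/
theorem time_space_reconstruction_minus_interpolant {X : Type*} [NormedAddCommGroup X]
    [NormedSpace ℂ X] [CompleteSpace X] (R R' P : X →L[ℂ] X)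
    (tn tn1 : ℝ) (h : tn < tn1) (U0 U1 : X) (W : ℝ → X) (W1 : X)
    (hW : ∀ t, W t = W ((tn + tn1) / 2) + (t - (tn + tn1) / 2) • W1)
    (hscheme : U1 - P U0 = (tn1 - tn) • W ((tn + tn1) / 2))
    (Uhat : ℝ → X)
    (hUhat : ∀ t, Uhat t = R U0 + ((t - tn) / (tn1 - tn)) • (R' (P U0) - R U0)
      + ∫ s in tn..t, R' (W s))
    (ω : ℝ → X)
    (hω : ∀ t, ω t = ((tn1 - t) / (tn1 - tn)) • R U0 + ((t - tn) / (tn1 - tn)) • R' U1) :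
    ∀ t ∈ Set.Icc tn tn1,
      Uhat t - ω t = (-(1 / 2) * (tn1 - t) * (t - tn)) • R' W1 := by
  intro t _
  have hk : tn1 - tn ≠ 0 := (sub_pos.mpr h).ne'
  have hsmul (c : ℝ) (x : X) : R' (c • x) = c • R' x :=
    (R'.restrictScalars ℝ).map_smul c x
  have hRW (s : ℝ) : R' (W s) =
      R' (W ((tn + tn1) / 2)) + (s - (tn + tn1) / 2) • R' W1 := by
    rw [hW s, map_add, hsmul]
  have hint : ∫ s in tn..t, R' (W s) = (t - tn) • R' (W ((tn + tn1) / 2)) +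
      ((t - tn) * ((tn + t) / 2 - (tn + tn1) / 2)) • R' W1 := by
    rw [← intervalIntegral_add_sub_smul]
    exact intervalIntegral.integral_congr fun s _ => hRW s
  have hU1 : R' U1 = R' (P U0) + (tn1 - tn) • R' (W ((tn + tn1) / 2)) := by
    rw [← hsmul, ← hscheme, ← map_add, add_sub_cancel]
  rw [hUhat, hω, hint, hU1]
  match_scalars <;> field_simp <;> ring
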